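/- Let k be an algebraically closed field of characteristic 0 and set x_21 := x_2x_1 + x_1x_2 in the free algebra k⟨x_1,x_2⟩. The defining ideal J(V(−1,2)) of the Nichols algebra of the block V(−1,2) is the two-sided ideal generated by the two elements x_1² and x_2x_21 − x_21x_2 − x_1x_21; the images of the monomials x_1^a x_21^b x_2^c for a ∈ {0,1} and b, c ∈ ℕ form a k-basis of B(V(−1,2)); and GKdim B(V(−1,2)) = 2. (This Nichols algebra is the super Jordan plane.) -/

import Mathlib

open scoped ENNReal

/-- The Gelfand–Kirillov dimension of a `k`-algebra `A`. -/
noncomputable def GKdim (k A : Type*) [Field k] [Ring A] [Algebra k A] : ℝ≥0∞ :=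
  ⨆ (V : Submodule k A) (_ : FiniteDimensional k V),
    Filter.limsup
      (fun n : ℕ =>
        ENNReal.ofReal
          (Real.log ((Module.finrank k (↥(∑ j ∈ Finset.range (n + 1), V ^ j)) : ℕ) : ℝ) /
            Real.log (n : ℝ)))
      Filter.atTop

/-- The degree-`n` homogeneous component of the free algebra on `2` generators. -/
noncomputable def degComp (k : Type*) [Field k] (n : ℕ) :
    Submodule k (FreeAlgebra k (Fin 2)) :=
  (Submodule.span k (Set.range (FreeAlgebra.ι k : Fin 2 → FreeAlgebra k (Fin 2)))) ^ n

/-- Generating set of the defining ideal `J(V(-1,2))` of the Nichols algebra. -/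
def nicholsSet {k : Type*} [Field k]
    (D : Fin 2 → (FreeAlgebra k (Fin 2) →ₗ[k] FreeAlgebra k (Fin 2))) :
    Set (FreeAlgebra k (Fin 2)) :=
  {x | ∃ n : ℕ, 2 ≤ n ∧ x ∈ degComp k n ∧
    ∀ l : List (Fin 2), l.length = n → l.foldr (fun i y => D i y) x = 0}

/-- Relation presenting the Nichols algebra `B(V(-1,2))` as a `RingQuot`. -/
def nicholsRel {k : Type*} [Field k]
    (D : Fin 2 → (FreeAlgebra k (Fin 2) →ₗ[k] FreeAlgebra k (Fin 2)))
    (a b : FreeAlgebra k (Fin 2)) : Prop :=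
  a ∈ nicholsSet D ∧ b = 0

/-- The extension to the free algebra of the action of `g` on the block `V(-1,2)`:
`g·x₁ = -x₁`, `g·x₂ = -x₂ + x₁`. -/
noncomputable def superJordanAut (k : Type*) [Field k] :
    FreeAlgebra k (Fin 2) →ₐ[k] FreeAlgebra k (Fin 2) :=
  FreeAlgebra.lift k
    ![-FreeAlgebra.ι k (0 : Fin 2),
      -FreeAlgebra.ι k (1 : Fin 2) + FreeAlgebra.ι k (0 : Fin 2)]

/-- The element `x₂₁ := x₂x₁ + x₁x₂` of the free algebra on `x₁, x₂`. -/
noncomputable def x21 (k : Type*) [Field k] : FreeAlgebra k (Fin 2) :=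
  FreeAlgebra.ι k (1 : Fin 2) * FreeAlgebra.ι k (0 : Fin 2) +
    FreeAlgebra.ι k (0 : Fin 2) * FreeAlgebra.ι k (1 : Fin 2)

/-- The defining relations of the super Jordan plane for a pair `X`, `Y` of ring elements. -/
structure SuperJordanRel {A : Type*} [Ring A] (X Y : A) : Prop where
  sq : X * X = 0
  comm : Y * (Y * X + X * Y) - (Y * X + X * Y) * Y - X * (Y * X + X * Y) = 0

namespace SuperJordanRel

variable {A : Type*} [Ring A] {X Y : A}

section

variable (h : SuperJordanRel X Y)
include h

theorem left_comm_z : X * (Y * X + X * Y) = (Y * X + X * Y) * X := by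
  have := h.sq
  linear_combination (norm := noncomm_ring) this * Y - Y * this

theorem right_mul_z : Y * (Y * X + X * Y) = (Y * X + X * Y) * Y + X * (Y * X + X * Y) := by
  linear_combination (norm := noncomm_ring) h.comm

theorem right_mul_z_pow (n : ℕ) :
    Y * (Y * X + X * Y) ^ n = (Y * X + X * Y) ^ n * Y + n * (X * (Y * X + X * Y) ^ n) := by
  have hc := h.left_comm_z
  have hr := h.right_mul_z
  generalize Y * X + X * Y = Z at *
  induction n with
  | zero => simp
  | succ n ih =>
    have hcn : X * Z ^ n = Z ^ n * X := (Commute.pow_right (a := X) hc n).eq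
    calc Y * Z ^ (n + 1) = (Y * Z ^ n) * Z := by rw [pow_succ, mul_assoc]
      _ = Z ^ n * (Y * Z) + n * (X * Z ^ n * Z) := by rw [ih]; noncomm_ring
      _ = Z ^ n * Z * Y + (Z ^ n * X) * Z + n * (X * Z ^ n * Z) := by rw [hr]; noncomm_ring
      _ = _ := by rw [← hcn, pow_succ]; push_cast; noncomm_ring

theorem right_sq_mul_left : Y ^ 2 * X = X * (Y ^ 2 + (Y * X + X * Y)) := by
  linear_combination (norm := noncomm_ring) h.comm

theorem right_sq_mul_z :
    Y ^ 2 * (Y * X + X * Y) = (Y * X + X * Y) * Y ^ 2 + (Y * X + X * Y) ^ 2 := by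
  have hr := h.right_mul_z
  have e : Y ^ 2 * (Y * X + X * Y) = Y * (Y * (Y * X + X * Y)) := by noncomm_ring
  rw [e, hr, mul_add, ← mul_assoc, hr]
  linear_combination (norm := noncomm_ring) -(X * hr) - h.sq * (Y * X + X * Y)

theorem sq_sub_z_pow (n : ℕ) : (Y ^ 2 - (Y * X + X * Y)) ^ (n + 1) =
    (Y ^ 2) ^ (n + 1) - (n + 1 : ℕ) * ((Y * X + X * Y) * (Y ^ 2) ^ n) := by
  have ht := h.right_sq_mul_z
  generalize Y * X + X * Y = Z at *
  generalize Y ^ 2 = T at *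
  induction n with
  | zero => simp
  | succ n ih =>
    rw [pow_succ', ih]
    have hz : T * (Z * T ^ n) = Z * T ^ (n + 1) + Z ^ 2 * T ^ n := by
      rw [← mul_assoc, ht, add_mul, pow_succ' T, mul_assoc]
    have e1 : T * ((n + 1 : ℕ) * (Z * T ^ n)) = (n + 1 : ℕ) * (T * (Z * T ^ n)) :=
      (Nat.cast_commute (n + 1) T).left_comm _ |>.symm
    have e2 : Z * ((n + 1 : ℕ) * (Z * T ^ n)) = (n + 1 : ℕ) * (Z * (Z * T ^ n)) :=
      (Nat.cast_commute (n + 1) Z).left_comm _ |>.symm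
    rw [sub_mul, mul_sub, mul_sub, e1, e2, hz, ← pow_succ']
    push_cast
    noncomm_ring

theorem derivative_step (n : ℕ) :
    X * (Y ^ 2 - (Y * X + X * Y)) ^ (n + 1) + Y ^ 2 * ((n + 1 : ℕ) * (X * (Y ^ 2) ^ n)) =
      (n + 2 : ℕ) * (X * (Y ^ 2) ^ (n + 1)) := by
  have hx := h.right_sq_mul_left
  rw [h.sq_sub_z_pow]
  generalize Y * X + X * Y = Z at *
  generalize Y ^ 2 = T at *
  have e1 : T * ((n + 1 : ℕ) * (X * T ^ n)) = (n + 1 : ℕ) * (T * (X * T ^ n)) :=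
    (Nat.cast_commute (n + 1) T).left_comm _ |>.symm
  have e2 : X * ((n + 1 : ℕ) * (Z * T ^ n)) = (n + 1 : ℕ) * (X * (Z * T ^ n)) :=
    (Nat.cast_commute (n + 1) X).left_comm _ |>.symm
  rw [mul_sub, e1, e2, ← mul_assoc T, hx, pow_succ' T]
  push_cast
  noncomm_ring

end

end SuperJordanRel

/-- A linear map `E` that lowers the first index of a doubly indexed family detects linear
independence of the family, modulo the kernel of `π`, on its lowest layer. -/
theorem eq_zero_of_lowering {k F Q γ : Type*} [Field k] [AddCommGroup F] [Module k F]
    [AddCommGroup Q] [Module k Q] (π : F →ₗ[k] Q) (E : F →ₗ[k] F)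
    (hE : ∀ x, π x = 0 → π (E x) = 0) (v : ℕ → γ → F)
    (c : ℕ → k) (hc : ∀ n, c n ≠ 0)
    (hsucc : ∀ n i, π (E (v (n + 1) i)) = c n • π (v n i)) (hzero : ∀ i, π (E (v 0 i)) = 0)
    (hli : LinearIndependent k fun i => π (v 0 i)) (N : ℕ) (f : ℕ → γ →₀ k)
    (hf : ∑ n ∈ Finset.range N, Finsupp.linearCombination k (fun i => π (v n i)) (f n) = 0) :
    ∀ n < N, f n = 0 := by
  induction N generalizing f with
  | zero => simp
  | succ N ih =>
    have hcomb (n : ℕ) (g : γ →₀ k) : π (Finsupp.linearCombination k (v n) g) =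
        Finsupp.linearCombination k (fun i => π (v n i)) g := by
      rw [Finsupp.apply_linearCombination]; rfl
    have h1 : π (E (∑ n ∈ Finset.range (N + 1), Finsupp.linearCombination k (v n) (f n))) = 0 := by
      apply hE
      rw [map_sum, ← hf]
      exact Finset.sum_congr rfl fun n _ => hcomb n _
    have hE0 : π (E (Finsupp.linearCombination k (v 0) (f 0))) = 0 := by
      rw [← LinearMap.comp_apply, Finsupp.apply_linearCombination]
      have : (⇑(π ∘ₗ E) ∘ v 0) = 0 := funext hzero
      rw [this]; simp
    have hEs (n : ℕ) : π (E (Finsupp.linearCombination k (v (n + 1)) (f (n + 1)))) =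
        Finsupp.linearCombination k (fun i => π (v n i)) (c n • f (n + 1)) := by
      rw [← LinearMap.comp_apply, Finsupp.apply_linearCombination, map_smul]
      have : (⇑(π ∘ₗ E) ∘ v (n + 1)) = fun i => c n • π (v n i) := funext (hsucc n)
      rw [this]
      simp only [Finsupp.linearCombination_apply, Finsupp.sum, Finset.smul_sum]
      exact Finset.sum_congr rfl fun i _ => smul_comm _ _ _
    have h2 : ∀ n < N, c n • f (n + 1) = 0 := by
      apply ih (fun n => c n • f (n + 1))
      rw [Finset.sum_range_succ', map_add, map_add, hE0, add_zero, map_sum, map_sum] at h1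
      rw [← h1]
      exact Finset.sum_congr rfl fun n _ => (hEs n).symm
    have h3 (n : ℕ) (hn : n < N) : f (n + 1) = 0 := (smul_eq_zero.mp (h2 n hn)).resolve_left (hc n)
    have h4 : f 0 = 0 := by
      rw [Finset.sum_range_succ', Finset.sum_eq_zero, zero_add] at hf
      · exact linearIndependent_iff.mp hli _ hf
      · intro n hn
        rw [h3 n (Finset.mem_range.mp hn), map_zero]
    rintro (_ | n) hn
    · exact h4
    · exact h3 n (by omega)

/-- The inverse of `superJordanAut`. -/
noncomputable def superJordanAutInv (k : Type*) [Field k] :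
    FreeAlgebra k (Fin 2) →ₐ[k] FreeAlgebra k (Fin 2) :=
  FreeAlgebra.lift k
    ![-FreeAlgebra.ι k (0 : Fin 2),
      -FreeAlgebra.ι k (1 : Fin 2) - FreeAlgebra.ι k (0 : Fin 2)]

/-- The augmentation of the free algebra on two generators. -/
noncomputable def augmentation (k : Type*) [Field k] : FreeAlgebra k (Fin 2) →ₐ[k] k :=
  FreeAlgebra.lift k 0

section Automorphism

variable {k : Type*} [Field k]

open FreeAlgebra

@[simp] theorem superJordanAut_ι_zero : superJordanAut k (ι k 0) = -ι k 0 := by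
  simp [superJordanAut]

@[simp] theorem superJordanAut_ι_one : superJordanAut k (ι k 1) = -ι k 1 + ι k 0 := by
  simp [superJordanAut]

@[simp] theorem superJordanAutInv_ι_zero : superJordanAutInv k (ι k 0) = -ι k 0 := by
  simp [superJordanAutInv]

@[simp] theorem superJordanAutInv_ι_one :
    superJordanAutInv k (ι k 1) = -ι k 1 - ι k 0 := by
  simp [superJordanAutInv]

@[simp] theorem augmentation_ι (i : Fin 2) : augmentation k (ι k i) = 0 := by
  simp [augmentation]

@[simp] theorem superJordanAutInv_superJordanAut (x : FreeAlgebra k (Fin 2)) :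
    superJordanAutInv k (superJordanAut k x) = x := by
  have : (superJordanAutInv k).comp (superJordanAut k) = AlgHom.id k _ := by
    ext i
    fin_cases i <;> simp
  exact DFunLike.congr_fun this x

@[simp] theorem superJordanAut_superJordanAutInv (x : FreeAlgebra k (Fin 2)) :
    superJordanAut k (superJordanAutInv k x) = x := by
  have : (superJordanAut k).comp (superJordanAutInv k) = AlgHom.id k _ := by
    ext i
    fin_cases i <;> simp
  exact DFunLike.congr_fun this x

@[simp] theorem augmentation_superJordanAut (x : FreeAlgebra k (Fin 2)) :
    augmentation k (superJordanAut k x) = augmentation k x := by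
  have : (augmentation k).comp (superJordanAut k) = augmentation k := by
    ext i
    fin_cases i <;> simp
  exact DFunLike.congr_fun this x

@[simp] theorem augmentation_superJordanAutInv (x : FreeAlgebra k (Fin 2)) :
    augmentation k (superJordanAutInv k x) = augmentation k x := by
  rw [← augmentation_superJordanAut, superJordanAut_superJordanAutInv]

theorem ι_mem_degComp (i : Fin 2) : ι k i ∈ degComp k 1 := by
  rw [degComp, pow_one]
  exact Submodule.subset_span ⟨i, rfl⟩

theorem mul_mem_degComp {m n : ℕ} {x y : FreeAlgebra k (Fin 2)} (hx : x ∈ degComp k m)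
    (hy : y ∈ degComp k n) : x * y ∈ degComp k (m + n) := by
  rw [degComp, pow_add]
  exact Submodule.mul_mem_mul hx hy

theorem ι_pow_mem_degComp (i : Fin 2) (n : ℕ) : ι k i ^ n ∈ degComp k n := by
  simpa [degComp] using Submodule.pow_mem_pow _ (ι_mem_degComp (k := k) i) n

theorem degComp_zero_eq : degComp k 0 = 1 := pow_zero _

/-- Homogeneous elements of positive degree are sums of products with a generator on the left. -/
theorem degComp_succ_induction {n : ℕ} {p : FreeAlgebra k (Fin 2) → Prop} (h0 : p 0)
    (hadd : ∀ x y, p x → p y → p (x + y)) (hmul : ∀ i, ∀ x ∈ degComp k n, p (ι k i * x))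
    {x : FreeAlgebra k (Fin 2)} (hx : x ∈ degComp k (n + 1)) : p x := by
  rw [degComp, pow_succ'] at hx
  induction hx using Submodule.mul_induction_on' with
  | mem_mul_mem u hu v hv =>
    induction hu using Submodule.span_induction generalizing v with
    | mem u hu =>
      obtain ⟨i, rfl⟩ := hu
      exact hmul i v hv
    | zero => simpa using h0
    | add a b _ _ ha hb =>
      rw [add_mul]
      exact hadd _ _ (ha v hv) (hb v hv)
    | smul c a _ ha =>
      rw [smul_mul_assoc, ← mul_smul_comm]
      exact ha _ (Submodule.smul_mem _ c hv)
  | add a _ b _ ha hb => exact hadd _ _ ha hb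

theorem superJordanAut_mem_degComp {n : ℕ} {x : FreeAlgebra k (Fin 2)} (hx : x ∈ degComp k n) :
    superJordanAut k x ∈ degComp k n := by
  induction n generalizing x with
  | zero =>
    rw [degComp_zero_eq] at *
    obtain ⟨r, rfl⟩ := Submodule.mem_one.mp hx
    simp
  | succ n ih =>
    refine degComp_succ_induction (p := fun x => superJordanAut k x ∈ degComp k (n + 1))
      (by simp) (fun x y hx hy => ?_) (fun i x hx => ?_) hx
    · rw [map_add]
      exact add_mem hx hy
    · rw [map_mul, add_comm]
      refine mul_mem_degComp ?_ (ih hx)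
      fin_cases i
      · simpa using ι_mem_degComp 0
      · simpa using add_mem (neg_mem (ι_mem_degComp 1)) (ι_mem_degComp 0)

theorem augmentation_eq_zero {n : ℕ} {x : FreeAlgebra k (Fin 2)} (hx : x ∈ degComp k (n + 1)) :
    augmentation k x = 0 :=
  degComp_succ_induction (p := fun x => augmentation k x = 0) (by simp)
    (fun x y hx hy => by simp [hx, hy]) (fun i x _ => by simp) hx

end Automorphism

/-- A pair of skew derivations of the free algebra defining the Nichols algebra of `V(-1,2)`. -/
structure IsSkewDerivation {k : Type*} [Field k]
    (D : Fin 2 → (FreeAlgebra k (Fin 2) →ₗ[k] FreeAlgebra k (Fin 2))) : Prop where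
  one : ∀ i, D i 1 = 0
  apply_ι : ∀ i j, D i (FreeAlgebra.ι k j) = if i = j then 1 else 0
  leibniz : ∀ i u v, D i (u * v) = D i u * superJordanAut k v + u * D i v

namespace IsSkewDerivation

variable {k : Type*} [Field k] {D : Fin 2 → (FreeAlgebra k (Fin 2) →ₗ[k] FreeAlgebra k (Fin 2))}

open FreeAlgebra

section

variable (hD : IsSkewDerivation D)
include hD

theorem map_algebraMap (i : Fin 2) (r : k) : D i (algebraMap k _ r) = 0 := by
  rw [Algebra.algebraMap_eq_smul_one, map_smul, hD.one, smul_zero]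

theorem superJordanAut_comm (x : FreeAlgebra k (Fin 2)) :
    D 0 (superJordanAut k x) = superJordanAut k (-D 0 x + D 1 x) ∧
      D 1 (superJordanAut k x) = superJordanAut k (-D 1 x) := by
  induction x using FreeAlgebra.induction with
  | grade0 r => simp [hD.map_algebraMap]
  | grade1 i => fin_cases i <;> simp [hD.apply_ι]
  | mul a b ha hb =>
    simp only [map_mul, hD.leibniz, ha.1, ha.2, hb.1, hb.2, map_add, map_neg]
    constructor <;> noncomm_ring
  | add a b ha hb =>
    simp only [map_add, ha.1, ha.2, hb.1, hb.2, map_neg]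
    constructor <;> abel

theorem superJordanAutInv_comm (x : FreeAlgebra k (Fin 2)) :
    D 0 (superJordanAutInv k x) = superJordanAutInv k (-D 0 x - D 1 x) ∧
      D 1 (superJordanAutInv k x) = superJordanAutInv k (-D 1 x) := by
  have h := hD.superJordanAut_comm (superJordanAutInv k x)
  simp only [superJordanAut_superJordanAutInv] at h
  constructor <;> simp [h.1, h.2]

theorem map_mem_degComp (i : Fin 2) {n : ℕ} {x : FreeAlgebra k (Fin 2)}
    (hx : x ∈ degComp k (n + 1)) : D i x ∈ degComp k n := by
  induction n generalizing x with
  | zero =>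
    refine degComp_succ_induction (p := fun x => D i x ∈ degComp k 0)
      (by simp) (fun x y hx hy => ?_) (fun j x hx => ?_) hx
    · rw [map_add]
      exact add_mem hx hy
    · rw [degComp_zero_eq] at *
      obtain ⟨r, rfl⟩ := Submodule.mem_one.mp hx
      rw [hD.leibniz, hD.map_algebraMap, hD.apply_ι]
      split_ifs <;> simp
  | succ n ih =>
    refine degComp_succ_induction (p := fun x => D i x ∈ degComp k (n + 1))
      (by simp) (fun x y hx hy => ?_) (fun j x hx => ?_) hx
    · rw [map_add]
      exact add_mem hx hy
    · rw [hD.leibniz, hD.apply_ι]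
      refine add_mem ?_ ?_
      · split_ifs
        · simpa using superJordanAut_mem_degComp hx
        · simp
      · rw [add_comm n]
        exact mul_mem_degComp (ι_mem_degComp j) (ih hx)

theorem map_of_mem_degComp_zero (i : Fin 2) {x : FreeAlgebra k (Fin 2)} (hx : x ∈ degComp k 0) :
    D i x = 0 := by
  rw [degComp_zero_eq] at hx
  obtain ⟨r, rfl⟩ := Submodule.mem_one.mp hx
  exact hD.map_algebraMap i r

end

end IsSkewDerivation

/-- The composition of the maps `D i` along a list, the head of the list being applied first. -/
noncomputable def iteratedDerivation {k : Type*} [Field k]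
    (D : Fin 2 → (FreeAlgebra k (Fin 2) →ₗ[k] FreeAlgebra k (Fin 2))) :
    List (Fin 2) → (FreeAlgebra k (Fin 2) →ₗ[k] FreeAlgebra k (Fin 2))
  | [] => LinearMap.id
  | i :: l => iteratedDerivation D l ∘ₗ D i

namespace IsSkewDerivation

variable {k : Type*} [Field k] {D : Fin 2 → (FreeAlgebra k (Fin 2) →ₗ[k] FreeAlgebra k (Fin 2))}

open FreeAlgebra

theorem iteratedDerivation_eq_foldr (l : List (Fin 2)) (x : FreeAlgebra k (Fin 2)) :
    iteratedDerivation D l x = l.reverse.foldr (fun i y => D i y) x := by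
  rw [List.foldr_reverse]
  induction l generalizing x with
  | nil => rfl
  | cons i l ih => exact ih (D i x)

theorem augmentation_iteratedDerivation_of_ne (hD : IsSkewDerivation D) (l : List (Fin 2))
    {n : ℕ} (hn : l.length ≠ n) {x : FreeAlgebra k (Fin 2)} (hx : x ∈ degComp k n) :
    augmentation k (iteratedDerivation D l x) = 0 := by
  induction l generalizing n x with
  | nil =>
    obtain _ | n := n
    · simp at hn
    · exact augmentation_eq_zero hx
  | cons i l ih =>
    obtain _ | n := n
    · simp [iteratedDerivation, hD.map_of_mem_degComp_zero i hx]
    · exact ih (by simpa using hn) (hD.map_mem_degComp i hx)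

/-- The elements all of whose iterated skew derivatives have vanishing augmentation. -/
def kernelSubmodule (D : Fin 2 → (FreeAlgebra k (Fin 2) →ₗ[k] FreeAlgebra k (Fin 2))) :
    Submodule k (FreeAlgebra k (Fin 2)) where
  carrier := {x | ∀ l, augmentation k (iteratedDerivation D l x) = 0}
  add_mem' hx hy l := by simp [hx l, hy l]
  zero_mem' l := by simp
  smul_mem' c x hx l := by simp [hx l]

theorem augmentation_of_mem {x : FreeAlgebra k (Fin 2)} (hx : x ∈ kernelSubmodule D) :
    augmentation k x = 0 := hx []

theorem apply_mem {x : FreeAlgebra k (Fin 2)} (hx : x ∈ kernelSubmodule D) (i : Fin 2) :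
    D i x ∈ kernelSubmodule D := fun l => hx (i :: l)

section

variable (hD : IsSkewDerivation D)
include hD

theorem superJordanAut_mem {x : FreeAlgebra k (Fin 2)} (hx : x ∈ kernelSubmodule D) :
    superJordanAut k x ∈ kernelSubmodule D := by
  intro l
  induction l generalizing x with
  | nil => simp [iteratedDerivation, augmentation_of_mem hx]
  | cons i l ih =>
    have h0 := apply_mem hx 0
    have h1 := apply_mem hx 1
    fin_cases i <;> simp only [iteratedDerivation, LinearMap.comp_apply, Fin.zero_eta, Fin.mk_one,
      (hD.superJordanAut_comm x).1, (hD.superJordanAut_comm x).2]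
    · exact ih (add_mem (neg_mem h0) h1)
    · exact ih (neg_mem h1)

theorem superJordanAutInv_mem {x : FreeAlgebra k (Fin 2)} (hx : x ∈ kernelSubmodule D) :
    superJordanAutInv k x ∈ kernelSubmodule D := by
  intro l
  induction l generalizing x with
  | nil => simp [iteratedDerivation, augmentation_of_mem hx]
  | cons i l ih =>
    have h0 := apply_mem hx 0
    have h1 := apply_mem hx 1
    fin_cases i <;> simp only [iteratedDerivation, LinearMap.comp_apply, Fin.zero_eta, Fin.mk_one,
      (hD.superJordanAutInv_comm x).1, (hD.superJordanAutInv_comm x).2]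
    · exact ih (sub_mem (neg_mem h0) h1)
    · exact ih (neg_mem h1)

theorem mul_mem_left (u : FreeAlgebra k (Fin 2)) {x : FreeAlgebra k (Fin 2)}
    (hx : x ∈ kernelSubmodule D) : u * x ∈ kernelSubmodule D := by
  intro l
  induction l generalizing u x with
  | nil => simp [iteratedDerivation, augmentation_of_mem hx]
  | cons i l ih =>
    rw [iteratedDerivation, LinearMap.comp_apply, hD.leibniz, map_add, map_add,
      ih _ (hD.superJordanAut_mem hx), ih _ (apply_mem hx i), add_zero]

theorem mul_mem_right (u : FreeAlgebra k (Fin 2)) {x : FreeAlgebra k (Fin 2)}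
    (hx : x ∈ kernelSubmodule D) : x * u ∈ kernelSubmodule D := by
  intro l
  induction l generalizing u x with
  | nil => simp [iteratedDerivation, augmentation_of_mem hx]
  | cons i l ih =>
    rw [iteratedDerivation, LinearMap.comp_apply, hD.leibniz, map_add, map_add,
      ih _ hx, ih _ (apply_mem hx i), add_zero]

end

/-- The largest ideal in the kernel of the augmentation stable under skew derivations. -/
def kernel (hD : IsSkewDerivation D) : Ideal (FreeAlgebra k (Fin 2)) where
  __ := kernelSubmodule D
  smul_mem' u _ hx := hD.mul_mem_left u hx

instance (hD : IsSkewDerivation D) : hD.kernel.IsTwoSided where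
  mul_mem_of_left u hx := hD.mul_mem_right u hx

theorem nicholsSet_subset (hD : IsSkewDerivation D) {x : FreeAlgebra k (Fin 2)}
    (hx : x ∈ nicholsSet D) : x ∈ kernelSubmodule D := by
  obtain ⟨n, -, hn, h⟩ := hx
  intro l
  by_cases hl : l.length = n
  · rw [iteratedDerivation_eq_foldr, h _ (by simpa using hl), map_zero]
  · exact hD.augmentation_iteratedDerivation_of_ne l hl hn

section

variable (hD : IsSkewDerivation D)
include hD

theorem apply_sq (i : Fin 2) : D i (ι k 0 * ι k 0) = 0 := by
  simp [hD.leibniz, hD.apply_ι]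

theorem apply_zero_x21 : D 0 (x21 k) = ι k 0 := by
  simp [x21, hD.leibniz, hD.apply_ι]

theorem apply_one_x21 : D 1 (x21 k) = 0 := by
  simp [x21, hD.leibniz, hD.apply_ι]

omit hD in
theorem superJordanAut_x21 : superJordanAut k (x21 k) = x21 k - 2 * (ι k 0 * ι k 0) := by
  simp only [x21, map_add, map_mul, superJordanAut_ι_zero, superJordanAut_ι_one]
  noncomm_ring

omit hD in
theorem superJordanAutInv_x21 : superJordanAutInv k (x21 k) = x21 k + 2 * (ι k 0 * ι k 0) := by
  simp only [x21, map_add, map_mul, superJordanAutInv_ι_zero, superJordanAutInv_ι_one]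
  noncomm_ring

theorem apply_comm_rel (i : Fin 2) :
    D i (ι k 1 * x21 k - x21 k * ι k 1 - ι k 0 * x21 k) =
      if i = 0 then 0 else (-2 : k) • (ι k 0 * ι k 0) := by
  fin_cases i
  · simp [hD.leibniz, hD.apply_ι, hD.apply_zero_x21, superJordanAut_x21]
    simp only [x21]
    noncomm_ring
  · simp [hD.leibniz, hD.apply_ι, hD.apply_one_x21, superJordanAut_x21, ofNat_smul_eq_nsmul]

theorem sq_mem_nicholsSet : ι k 0 * ι k 0 ∈ nicholsSet D := by
  refine ⟨2, le_rfl, mul_mem_degComp (ι_mem_degComp 0) (ι_mem_degComp 0), fun l hl => ?_⟩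
  match l, hl with
  | [i, j], _ => simp [hD.apply_sq]

omit hD in
theorem x21_mem_degComp : x21 k ∈ degComp k 2 :=
  add_mem (mul_mem_degComp (ι_mem_degComp 1) (ι_mem_degComp 0))
    (mul_mem_degComp (ι_mem_degComp 0) (ι_mem_degComp 1))

theorem comm_rel_mem_nicholsSet :
    ι k 1 * x21 k - x21 k * ι k 1 - ι k 0 * x21 k ∈ nicholsSet D := by
  refine ⟨3, by norm_num, ?_, fun l hl => ?_⟩
  · exact sub_mem (sub_mem (mul_mem_degComp (m := 1) (ι_mem_degComp 1) x21_mem_degComp)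
      (mul_mem_degComp (m := 2) x21_mem_degComp (ι_mem_degComp 1)))
      (mul_mem_degComp (m := 1) (ι_mem_degComp 0) x21_mem_degComp)
  · match l, hl with
    | [i, j, m], _ =>
      simp only [List.foldr_cons, List.foldr_nil, hD.apply_comm_rel]
      split_ifs <;> simp [hD.apply_sq]

theorem superJordanRel_of_map {A : Type*} [Ring A] [Algebra k A] (f : FreeAlgebra k (Fin 2) →ₐ[k] A)
    (hf : ∀ x ∈ nicholsSet D, f x = 0) : SuperJordanRel (f (ι k 0)) (f (ι k 1)) where
  sq := by simpa using hf _ hD.sq_mem_nicholsSet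
  comm := by simpa [x21] using hf _ hD.comm_rel_mem_nicholsSet

end

end IsSkewDerivation

namespace IsSkewDerivation

variable {k : Type*} [Field k] {D : Fin 2 → (FreeAlgebra k (Fin 2) →ₗ[k] FreeAlgebra k (Fin 2))}
  (hD : IsSkewDerivation D)

open FreeAlgebra

/-- The quotient map by the kernel ideal. -/
noncomputable abbrev kernelMk :
    FreeAlgebra k (Fin 2) →ₐ[k] FreeAlgebra k (Fin 2) ⧸ hD.kernel :=
  Ideal.Quotient.mkₐ k hD.kernel

theorem kernelMk_eq_zero {x : FreeAlgebra k (Fin 2)} :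
    hD.kernelMk x = 0 ↔ x ∈ kernelSubmodule D :=
  Ideal.Quotient.eq_zero_iff_mem

theorem superJordanRel_kernelMk : SuperJordanRel (hD.kernelMk (ι k 0)) (hD.kernelMk (ι k 1)) :=
  hD.superJordanRel_of_map _ fun _ hx => hD.kernelMk_eq_zero.mpr (hD.nicholsSet_subset hx)

/-- The twist of `D 0` that is a skew derivation acting on the left factor first. -/
noncomputable def twistedDerivation
    (D : Fin 2 → (FreeAlgebra k (Fin 2) →ₗ[k] FreeAlgebra k (Fin 2))) :
    FreeAlgebra k (Fin 2) →ₗ[k] FreeAlgebra k (Fin 2) :=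
  (superJordanAutInv k).toLinearMap ∘ₗ D 0

include hD in
theorem twistedDerivation_mul (u v : FreeAlgebra k (Fin 2)) :
    twistedDerivation D (u * v) =
      twistedDerivation D u * v + superJordanAutInv k u * twistedDerivation D v := by
  simp [twistedDerivation, hD.leibniz]

include hD in
theorem twistedDerivation_mem {x : FreeAlgebra k (Fin 2)} (hx : x ∈ kernelSubmodule D) :
    twistedDerivation D x ∈ kernelSubmodule D :=
  hD.superJordanAutInv_mem (apply_mem hx 0)

include hD in
theorem twistedDerivation_ι_zero : twistedDerivation D (ι k 0) = 1 := by
  simp [twistedDerivation, hD.apply_ι]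

include hD in
theorem twistedDerivation_ι_one_pow (n : ℕ) : twistedDerivation D (ι k 1 ^ n) = 0 := by
  induction n with
  | zero => simp [twistedDerivation, hD.one]
  | succ n ih =>
    rw [pow_succ', hD.twistedDerivation_mul, ih]
    simp [twistedDerivation, hD.apply_ι]

theorem kernelMk_superJordanAutInv_x21 :
    hD.kernelMk (superJordanAutInv k (x21 k)) = hD.kernelMk (x21 k) := by
  rw [superJordanAutInv_x21, map_add, map_mul, map_mul, hD.superJordanRel_kernelMk.sq, mul_zero,
    add_zero]

theorem kernelMk_x21 : hD.kernelMk (x21 k) = hD.kernelMk (ι k 1) * hD.kernelMk (ι k 0) +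
    hD.kernelMk (ι k 0) * hD.kernelMk (ι k 1) := by
  simp only [x21, map_add, map_mul]

theorem kernelMk_commute : Commute (hD.kernelMk (ι k 0)) (hD.kernelMk (x21 k)) := by
  rw [kernelMk_x21]
  exact hD.superJordanRel_kernelMk.left_comm_z

theorem kernelMk_twistedDerivation_x21_pow (n : ℕ) :
    hD.kernelMk (twistedDerivation D (x21 k ^ (n + 1))) =
      (-(n + 1 : ℕ) : k) • hD.kernelMk (ι k 0 * x21 k ^ n) := by
  induction n with
  | zero => simp [twistedDerivation, hD.apply_zero_x21]
  | succ n ih =>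
    have hz : twistedDerivation D (x21 k) = -ι k 0 := by
      simp [twistedDerivation, hD.apply_zero_x21]
    rw [pow_succ', hD.twistedDerivation_mul, map_add, map_mul, map_mul, hz, ih,
      kernelMk_superJordanAutInv_x21, mul_smul_comm, map_mul, ← mul_assoc,
      ← hD.kernelMk_commute.eq, mul_assoc, ← map_mul hD.kernelMk (x21 k), ← pow_succ', map_neg,
      map_mul, neg_mul]
    push_cast
    module

theorem kernelMk_twistedDerivation_even_succ (b c : ℕ) :
    hD.kernelMk (twistedDerivation D (x21 k ^ (b + 1) * ι k 1 ^ c)) =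
      (-(b + 1 : ℕ) : k) • hD.kernelMk (ι k 0 * x21 k ^ b * ι k 1 ^ c) := by
  rw [hD.twistedDerivation_mul, hD.twistedDerivation_ι_one_pow, mul_zero, add_zero, map_mul,
    kernelMk_twistedDerivation_x21_pow, smul_mul_assoc, map_mul _ (_ * _)]

theorem kernelMk_twistedDerivation_odd (b c : ℕ) :
    hD.kernelMk (twistedDerivation D (ι k 0 * x21 k ^ b * ι k 1 ^ c)) =
      hD.kernelMk (x21 k ^ b * ι k 1 ^ c) := by
  rw [mul_assoc, hD.twistedDerivation_mul, hD.twistedDerivation_ι_zero, one_mul, map_add,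
    add_eq_left, superJordanAutInv_ι_zero, map_mul]
  obtain _ | b := b
  · simp [hD.twistedDerivation_ι_one_pow]
  · rw [kernelMk_twistedDerivation_even_succ, mul_smul_comm, map_mul, map_mul, ← mul_assoc,
      ← mul_assoc, map_neg, neg_mul, hD.superJordanRel_kernelMk.sq]
    simp

theorem kernelMk_apply_one_sq_pow (m : ℕ) :
    hD.kernelMk (D 1 ((ι k 1 ^ 2) ^ (m + 1))) =
      (m + 1 : ℕ) * (hD.kernelMk (ι k 0) * (hD.kernelMk (ι k 1) ^ 2) ^ m) := by
  have h1 : D 1 (ι k 1 ^ 2) = ι k 0 := by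
    simp [pow_two, hD.leibniz, hD.apply_ι]
  have h := hD.superJordanRel_kernelMk
  have hg : hD.kernelMk (superJordanAut k (ι k 1 ^ 2)) = hD.kernelMk (ι k 1) ^ 2 -
      (hD.kernelMk (ι k 1) * hD.kernelMk (ι k 0) + hD.kernelMk (ι k 0) * hD.kernelMk (ι k 1)) := by
    rw [map_pow, superJordanAut_ι_one, map_pow, map_add, map_neg]
    linear_combination (norm := noncomm_ring) h.sq
  induction m with
  | zero => simpa using congrArg hD.kernelMk h1
  | succ m ih =>
    rw [pow_succ', hD.leibniz, map_add, map_mul, map_mul, h1, ih, map_pow, map_pow, hg, map_pow,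
      h.derivative_step]

end IsSkewDerivation

namespace IsSkewDerivation

variable {k : Type*} [Field k] [CharZero k]
  {D : Fin 2 → (FreeAlgebra k (Fin 2) →ₗ[k] FreeAlgebra k (Fin 2))} (hD : IsSkewDerivation D)

open FreeAlgebra

include hD in
theorem ι_one_sq_pow_notMem (m : ℕ) : (ι k 1 ^ 2) ^ m ∉ kernelSubmodule D := by
  induction m with
  | zero =>
    intro h
    simpa using augmentation_of_mem h
  | succ m ih =>
    intro h
    have h1 := hD.kernelMk_eq_zero.mpr (apply_mem h 1)
    rw [hD.kernelMk_apply_one_sq_pow, ← nsmul_eq_mul, ← Nat.cast_smul_eq_nsmul k, smul_eq_zero,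
      Nat.cast_eq_zero, or_iff_right (Nat.succ_ne_zero m), ← map_pow, ← map_pow, ← map_mul,
      kernelMk_eq_zero] at h1
    have h2 := hD.twistedDerivation_mem h1
    rw [hD.twistedDerivation_mul, hD.twistedDerivation_ι_zero, one_mul, ← pow_mul,
      hD.twistedDerivation_ι_one_pow, mul_zero, add_zero, pow_mul] at h2
    exact ih h2

include hD in
theorem ι_one_pow_notMem (n : ℕ) : ι k 1 ^ n ∉ kernelSubmodule D := by
  intro h
  refine hD.ι_one_sq_pow_notMem n ?_
  rw [← pow_mul, two_mul, pow_add]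
  exact hD.mul_mem_left _ h

theorem linearIndependent_ι_one_pow :
    LinearIndependent k fun n : ℕ => hD.kernelMk (ι k 1 ^ n) := by
  rw [linearIndependent_iff]
  intro l hl
  rw [Finsupp.linearCombination_apply, Finsupp.sum] at hl
  simp_rw [← map_smul] at hl
  rw [← map_sum, kernelMk_eq_zero] at hl
  ext n
  obtain ⟨L, hL⟩ := not_forall.mp (hD.ι_one_pow_notMem n)
  have hlen : L.length = n := by
    by_contra hne
    exact hL (hD.augmentation_iteratedDerivation_of_ne L hne (ι_pow_mem_degComp 1 n))
  have h := hl L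
  simp only [map_sum, map_smul] at h
  rw [Finset.sum_eq_single n] at h
  · exact (smul_eq_zero.mp h).resolve_right hL
  · intro m _ hm
    rw [hD.augmentation_iteratedDerivation_of_ne L (by rw [hlen]; exact hm.symm)
      (ι_pow_mem_degComp 1 m), smul_zero]
  · intro hn
    rw [Finsupp.notMem_support_iff.mp hn, zero_smul]

theorem linearIndependent_kernelMk :
    LinearIndependent k fun p : Fin 2 × ℕ × ℕ =>
      hD.kernelMk (ι k 0 ^ (p.1 : ℕ) * x21 k ^ p.2.1 * ι k 1 ^ p.2.2) := by
  let v : ℕ → ℕ → FreeAlgebra k (Fin 2) := fun w c => ι k 0 ^ (w % 2) * x21 k ^ (w / 2) * ι k 1 ^ c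
  have hv0 (b c : ℕ) : v (2 * b) c = x21 k ^ b * ι k 1 ^ c := by simp [v]
  have hv1 (b c : ℕ) : v (2 * b + 1) c = ι k 0 * x21 k ^ b * ι k 1 ^ c := by
    simp only [v]
    rw [show (2 * b + 1) % 2 = 1 by omega, show (2 * b + 1) / 2 = b by omega, pow_one]
  have key := eq_zero_of_lowering hD.kernelMk.toLinearMap (twistedDerivation D)
    (fun x hx => hD.kernelMk_eq_zero.mpr
      (hD.twistedDerivation_mem (hD.kernelMk_eq_zero.mp hx))) v
    (fun n => if Even n then 1 else -((n / 2 + 1 : ℕ) : k))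
    (fun n => by
      split_ifs
      · exact one_ne_zero
      · exact neg_ne_zero.mpr (Nat.cast_ne_zero.mpr (Nat.succ_ne_zero _)))
    (fun n c => by
      obtain ⟨b, rfl | rfl⟩ := n.even_or_odd'
      · rw [hv0, hv1, if_pos (even_two_mul b), one_smul]
        exact hD.kernelMk_twistedDerivation_odd b c
      · rw [show 2 * b + 1 + 1 = 2 * (b + 1) by ring, hv0, hv1,
          if_neg (Nat.not_even_iff_odd.mpr ⟨b, rfl⟩), show (2 * b + 1) / 2 = b by omega]
        exact hD.kernelMk_twistedDerivation_even_succ b c)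
    (fun c => by simp [v, hD.twistedDerivation_ι_one_pow])
    (by simpa [v] using hD.linearIndependent_ι_one_pow)
  have hli : LinearIndependent k fun p : ℕ × ℕ => hD.kernelMk (v p.1 p.2) := by
    rw [linearIndependent_iff]
    intro l hl
    obtain ⟨N, hN⟩ : ∃ N, l.curry.support ⊆ Finset.range N :=
      ⟨_, Finset.subset_range_sup_succ _⟩
    have hsum := key N l.curry (by
      rw [← hl, Finsupp.linearCombination_apply,
        ← Finsupp.sum_curry_index l (fun w c a => a • hD.kernelMk (v w c)),
        Finsupp.sum_of_support_subset _ hN _ (by simp)]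
      rfl)
    ext ⟨w, c⟩
    rw [← Finsupp.curry_apply]
    by_cases hw : w ∈ l.curry.support
    · rw [hsum w (Finset.mem_range.mp (hN hw))]
      rfl
    · rw [Finsupp.notMem_support_iff.mp hw]
      rfl
  have hinj : Function.Injective fun p : Fin 2 × ℕ × ℕ => (2 * p.2.1 + (p.1 : ℕ), p.2.2) := by
    rintro ⟨a, b, c⟩ ⟨a', b', c'⟩ h
    simp only [Prod.mk.injEq] at h
    have := a.2
    have := a'.2
    simp only [Prod.mk.injEq, Fin.ext_iff]
    omega
  convert hli.comp _ hinj using 2 with p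
  obtain ⟨a, b, c⟩ := p
  fin_cases a
  · simpa using congrArg hD.kernelMk (hv0 b c).symm
  · simpa using congrArg hD.kernelMk (hv1 b c).symm

end IsSkewDerivation

/-- The ordered monomial `X ^ a * Z ^ b * Y ^ c` with `Z = Y * X + X * Y`. -/
def superJordanMonomial {A : Type*} [Ring A] (X Y : A) (p : Fin 2 × ℕ × ℕ) : A :=
  X ^ (p.1 : ℕ) * (Y * X + X * Y) ^ p.2.1 * Y ^ p.2.2

theorem map_superJordanMonomial {k A : Type*} [Field k] [Ring A] [Algebra k A]
    (f : FreeAlgebra k (Fin 2) →ₐ[k] A) (p : Fin 2 × ℕ × ℕ) :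
    f (FreeAlgebra.ι k 0 ^ (p.1 : ℕ) * x21 k ^ p.2.1 * FreeAlgebra.ι k 1 ^ p.2.2) =
      superJordanMonomial (f (FreeAlgebra.ι k 0)) (f (FreeAlgebra.ι k 1)) p := by
  simp [superJordanMonomial, x21]

/-- The span of the ordered monomials of degree at most `n`. -/
def superJordanSpan (k : Type*) {A : Type*} [Field k] [Ring A] [Algebra k A] (X Y : A) (n : ℕ) :
    Submodule k A :=
  Submodule.span k (superJordanMonomial X Y '' {p | (p.1 : ℕ) + 2 * p.2.1 + p.2.2 ≤ n})

namespace SuperJordanRel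

variable {k A : Type*} [Field k] [Ring A] [Algebra k A] {X Y : A}

theorem monomial_mem {p : Fin 2 × ℕ × ℕ} {n : ℕ} (hp : (p.1 : ℕ) + 2 * p.2.1 + p.2.2 ≤ n) :
    superJordanMonomial X Y p ∈ superJordanSpan k X Y n :=
  Submodule.subset_span ⟨p, hp, rfl⟩

theorem superJordanSpan_mono {m n : ℕ} (h : m ≤ n) :
    superJordanSpan k X Y m ≤ superJordanSpan k X Y n :=
  Submodule.span_mono (Set.image_mono fun _ hp => le_trans hp h)

theorem left_mul_mem (h : SuperJordanRel X Y) {n : ℕ} {x : A} (hx : x ∈ superJordanSpan k X Y n) :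
    X * x ∈ superJordanSpan k X Y (n + 1) := by
  induction hx using Submodule.span_induction with
  | mem x hx =>
    obtain ⟨⟨a, b, c⟩, hp, rfl⟩ := hx
    fin_cases a
    · convert monomial_mem (p := (1, b, c)) (n := n + 1) ?_ using 1
      · simp [superJordanMonomial, mul_assoc]
      · have : 0 + 2 * b + c ≤ n := hp
        simp only [Fin.val_one]
        omega
    · have : X * superJordanMonomial X Y (1, b, c) = 0 := by
        simp [superJordanMonomial, ← mul_assoc, h.sq]
      exact this ▸ zero_mem _
  | zero => simp
  | add x y _ _ hx hy => rw [mul_add]; exact add_mem hx hy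
  | smul c x _ hx => rw [mul_smul_comm]; exact Submodule.smul_mem _ c hx

theorem right_mul_mem (h : SuperJordanRel X Y) {n : ℕ} {x : A} (hx : x ∈ superJordanSpan k X Y n) :
    Y * x ∈ superJordanSpan k X Y (n + 1) := by
  induction hx using Submodule.span_induction with
  | mem x hx =>
    obtain ⟨⟨a, b, c⟩, hp, rfl⟩ := hx
    fin_cases a
    · replace hp : 0 + 2 * b + c ≤ n := hp
      have e : Y * superJordanMonomial X Y (0, b, c) = superJordanMonomial X Y (0, b, c + 1) +
          (b : k) • superJordanMonomial X Y (1, b, c) := by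
        simp only [superJordanMonomial, Fin.val_zero, pow_zero, one_mul, Fin.val_one, pow_one]
        rw [← mul_assoc, h.right_mul_z_pow, add_mul, pow_succ', mul_assoc, Nat.cast_smul_eq_nsmul,
          nsmul_eq_mul, mul_assoc (b : A)]
      exact e ▸ add_mem (monomial_mem (by simp only [Fin.val_zero]; omega))
        (Submodule.smul_mem _ _ (monomial_mem (by simp only [Fin.val_one]; omega)))
    · replace hp : 1 + 2 * b + c ≤ n := hp
      have e : Y * superJordanMonomial X Y (1, b, c) = superJordanMonomial X Y (0, b + 1, c) -
          superJordanMonomial X Y (1, b, c + 1) := by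
        simp only [superJordanMonomial, Fin.val_zero, pow_zero, one_mul, Fin.val_one, pow_one]
        have hr := h.right_mul_z_pow b
        have hs := h.sq
        rw [pow_succ' _ b, pow_succ' Y c]
        generalize (Y * X + X * Y) ^ b = W at *
        have hs' : X * ((b : A) * (X * W)) = 0 := by
          rw [(Nat.cast_commute b X).symm.left_comm, ← mul_assoc X, hs, zero_mul, mul_zero]
        have hxy : X * (Y * W) = X * (W * Y) := by rw [hr, mul_add, hs', add_zero]
        linear_combination (norm := noncomm_ring) -hxy * Y ^ c
      exact e ▸ sub_mem (monomial_mem (by simp only [Fin.val_zero]; omega))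
        (monomial_mem (by simp only [Fin.val_one]; omega))
  | zero => simp
  | add x y _ _ hx hy => rw [mul_add]; exact add_mem hx hy
  | smul c x _ hx => rw [mul_smul_comm]; exact Submodule.smul_mem _ c hx

theorem superJordanSpan_le (n : ℕ) :
    superJordanSpan k X Y n ≤ Submodule.span k {1, X, Y} ^ n := by
  set W := Submodule.span k ({1, X, Y} : Set A) with hW
  have h1 : 1 ≤ W := Submodule.one_le.mpr (Submodule.subset_span (by simp))
  have hX : X ∈ W := Submodule.subset_span (by simp)
  have hY : Y ∈ W := Submodule.subset_span (by simp)
  have hZ : Y * X + X * Y ∈ W ^ 2 := by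
    rw [pow_two]
    exact add_mem (Submodule.mul_mem_mul hY hX) (Submodule.mul_mem_mul hX hY)
  refine Submodule.span_le.mpr ?_
  rintro _ ⟨⟨a, b, c⟩, hp, rfl⟩
  refine pow_le_pow_right₀ h1 hp ?_
  rw [pow_add, pow_add, pow_mul]
  exact Submodule.mul_mem_mul (Submodule.mul_mem_mul (Submodule.pow_mem_pow _ hX _)
    (Submodule.pow_mem_pow _ hZ _)) (Submodule.pow_mem_pow _ hY _)

theorem superJordanSpan_eq (h : SuperJordanRel X Y) (n : ℕ) :
    superJordanSpan k X Y n = Submodule.span k {1, X, Y} ^ n := by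
  refine le_antisymm (superJordanSpan_le n) ?_
  induction n with
  | zero =>
    rw [pow_zero, Submodule.one_le]
    convert monomial_mem (p := (0, 0, 0)) ?_ using 1 <;> simp [superJordanMonomial]
  | succ n ih =>
    rw [pow_succ']
    refine (mul_le_mul_right ih _).trans (Submodule.mul_le.mpr fun u hu v hv => ?_)
    induction hu using Submodule.span_induction with
    | mem u hu =>
      obtain rfl | rfl | rfl := hu
      · rw [one_mul]
        exact superJordanSpan_mono n.le_succ hv
      · exact h.left_mul_mem hv
      · exact h.right_mul_mem hv
    | zero => simp
    | add x y _ _ hx hy => rw [add_mul]; exact add_mem hx hy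
    | smul c x _ hx => rw [smul_mul_assoc]; exact Submodule.smul_mem _ c hx

theorem exists_mem_superJordanSpan (f : FreeAlgebra k (Fin 2) →ₐ[k] A)
    (h : SuperJordanRel (f (FreeAlgebra.ι k 0)) (f (FreeAlgebra.ι k 1)))
    (x : FreeAlgebra k (Fin 2)) :
    ∃ n, f x ∈ superJordanSpan k (f (FreeAlgebra.ι k 0)) (f (FreeAlgebra.ι k 1)) n := by
  induction x using FreeAlgebra.induction with
  | grade0 r =>
    refine ⟨0, ?_⟩
    rw [h.superJordanSpan_eq, pow_zero, AlgHom.commutes]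
    exact Submodule.algebraMap_mem r
  | grade1 i =>
    refine ⟨1, ?_⟩
    rw [h.superJordanSpan_eq, pow_one]
    fin_cases i <;> exact Submodule.subset_span (by simp)
  | mul a b ha hb =>
    obtain ⟨m, hm⟩ := ha
    obtain ⟨n, hn⟩ := hb
    refine ⟨m + n, ?_⟩
    rw [h.superJordanSpan_eq] at *
    rw [map_mul, pow_add]
    exact Submodule.mul_mem_mul hm hn
  | add a b ha hb =>
    obtain ⟨m, hm⟩ := ha
    obtain ⟨n, hn⟩ := hb
    refine ⟨max m n, ?_⟩
    rw [map_add]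
    exact add_mem (superJordanSpan_mono (le_max_left m n) hm)
      (superJordanSpan_mono (le_max_right m n) hn)

theorem mem_span_range_monomial (f : FreeAlgebra k (Fin 2) →ₐ[k] A)
    (h : SuperJordanRel (f (FreeAlgebra.ι k 0)) (f (FreeAlgebra.ι k 1)))
    (x : FreeAlgebra k (Fin 2)) :
    f x ∈ Submodule.span k (Set.range
      (superJordanMonomial (f (FreeAlgebra.ι k 0)) (f (FreeAlgebra.ι k 1)))) := by
  obtain ⟨n, hn⟩ := exists_mem_superJordanSpan f h x
  exact Submodule.span_mono (Set.image_subset_range _ _) hn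

end SuperJordanRel

theorem tendsto_log_mul_sq_div_log {C : ℝ} (hC : 0 < C) :
    Filter.Tendsto (fun n : ℕ => ENNReal.ofReal (Real.log (C * (n : ℝ) ^ 2) / Real.log n))
      Filter.atTop (nhds 2) := by
  have hlog : Filter.Tendsto (fun n : ℕ => Real.log n) Filter.atTop Filter.atTop :=
    Real.tendsto_log_atTop.comp tendsto_natCast_atTop_atTop
  have h : Filter.Tendsto (fun n : ℕ => Real.log C / Real.log n + 2) Filter.atTop (nhds 2) := by
    simpa using (hlog.const_div_atTop (Real.log C)).add_const 2
  have h2 : ENNReal.ofReal 2 = 2 := by simp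
  rw [← h2]
  refine (ENNReal.continuous_ofReal.tendsto 2).comp (h.congr' ?_)
  filter_upwards [Filter.eventually_ge_atTop 2] with n hn
  have hn' : (1 : ℝ) < n := by exact_mod_cast hn
  have hpos := Real.log_pos hn'
  rw [Real.log_mul hC.ne' (by positivity), Real.log_pow]
  field_simp
  norm_cast

namespace SuperJordanRel

variable {k A : Type*} [Field k] [Ring A] [Algebra k A] {X Y : A}

theorem superJordanSpan_le_span_finset (n : ℕ) [DecidableEq A] :
    superJordanSpan k X Y n ≤ Submodule.span k ↑((Finset.univ ×ˢ Finset.range (n + 1) ×ˢ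
      Finset.range (n + 1) : Finset (Fin 2 × ℕ × ℕ)).image (superJordanMonomial X Y)) := by
  refine Submodule.span_mono ?_
  rintro _ ⟨⟨a, b, c⟩, hp, rfl⟩
  replace hp : (a : ℕ) + 2 * b + c ≤ n := hp
  simp only [Finset.coe_image]
  refine ⟨(a, b, c), Finset.mem_coe.mpr ?_, rfl⟩
  simp only [Finset.mem_product, Finset.mem_univ, Finset.mem_range, true_and]
  omega

instance (n : ℕ) : FiniteDimensional k (superJordanSpan k X Y n) := by
  classical
  exact Submodule.finiteDimensional_of_le (superJordanSpan_le_span_finset n)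

theorem finrank_superJordanSpan_le (n : ℕ) :
    Module.finrank k (superJordanSpan k X Y n) ≤ 2 * (n + 1) ^ 2 := by
  classical
  refine (Submodule.finrank_mono (superJordanSpan_le_span_finset n)).trans
    ((finrank_span_finset_le_card _).trans (Finset.card_image_le.trans (le_of_eq ?_)))
  simp [Finset.card_product, pow_two]

theorem le_finrank_superJordanSpan (hli : LinearIndependent k (superJordanMonomial X Y)) (n : ℕ) :
    (n / 3 + 1) ^ 2 ≤ Module.finrank k (superJordanSpan k X Y n) := by
  let ind : Fin (n / 3 + 1) × Fin (n / 3 + 1) → Fin 2 × ℕ × ℕ := fun q => (0, q.1, q.2)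
  have hinj : Function.Injective ind := by
    rintro ⟨b, c⟩ ⟨b', c'⟩ h
    simpa [ind, Fin.ext_iff] using h
  let v : Fin (n / 3 + 1) × Fin (n / 3 + 1) → superJordanSpan k X Y n := fun q =>
    ⟨superJordanMonomial X Y (ind q), monomial_mem (by
      have := q.1.2
      have := q.2.2
      simp only [ind, Fin.val_zero]
      omega)⟩
  have hv : LinearIndependent k v :=
    LinearIndependent.of_comp (superJordanSpan k X Y n).subtype (hli.comp ind hinj)
  simpa [pow_two] using hv.fintype_card_le_finrank

theorem sum_pow_le {V U : Submodule k A} {n : ℕ} (h : ∀ j ≤ n, V ^ j ≤ U) :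
    ∑ j ∈ Finset.range (n + 1), V ^ j ≤ U :=
  Finset.sum_induction _ (· ≤ U) (fun _ _ ha hb => sup_le ha hb) bot_le
    fun j hj => h j (Nat.lt_succ_iff.mp (Finset.mem_range.mp hj))

theorem sum_span_pow (h : SuperJordanRel X Y) (n : ℕ) :
    ∑ j ∈ Finset.range (n + 1), Submodule.span k {1, X, Y} ^ j = superJordanSpan k X Y n := by
  refine le_antisymm (sum_pow_le fun j hj => ?_) ?_
  · rw [← h.superJordanSpan_eq]
    exact superJordanSpan_mono hj
  · rw [h.superJordanSpan_eq]
    exact Finset.single_le_sum (f := fun j => Submodule.span k {1, X, Y} ^ j)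
      (fun _ _ => bot_le) (Finset.self_mem_range_succ n)

theorem exists_le_superJordanSpan (htop : ∀ x : A, ∃ n, x ∈ superJordanSpan k X Y n)
    (V : Submodule k A) [FiniteDimensional k V] : ∃ d, V ≤ superJordanSpan k X Y d := by
  obtain ⟨s, rfl⟩ := (Submodule.fg_iff_finiteDimensional V).mpr inferInstance
  choose d hd using htop
  exact ⟨s.sup d, Submodule.span_le.mpr fun x hx =>
    superJordanSpan_mono (Finset.le_sup hx) (hd x)⟩

theorem GKdim_le (h : SuperJordanRel X Y) (htop : ∀ x : A, ∃ n, x ∈ superJordanSpan k X Y n) :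
    GKdim k A ≤ 2 := by
  refine iSup₂_le fun V _ => ?_
  obtain ⟨d, hd⟩ := exists_le_superJordanSpan htop V
  have hle (n : ℕ) : ∑ j ∈ Finset.range (n + 1), V ^ j ≤ superJordanSpan k X Y (d * n) := by
    refine sum_pow_le fun j hj => (pow_le_pow_left' hd j).trans ?_
    rw [h.superJordanSpan_eq, ← pow_mul, ← h.superJordanSpan_eq]
    exact superJordanSpan_mono (Nat.mul_le_mul_left d hj)
  have hC : (0 : ℝ) < 2 * (d + 1) ^ 2 := by positivity
  rw [← (tendsto_log_mul_sq_div_log hC).limsup_eq]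
  refine Filter.limsup_le_limsup ?_
  filter_upwards [Filter.eventually_ge_atTop 1] with n hn
  have hn' : (1 : ℝ) ≤ n := by exact_mod_cast hn
  refine ENNReal.ofReal_le_ofReal (div_le_div_of_nonneg_right ?_ (Real.log_nonneg hn'))
  have hfin : (Module.finrank k ↥(∑ j ∈ Finset.range (n + 1), V ^ j) : ℝ) ≤
      2 * (d + 1) ^ 2 * n ^ 2 := by
    have h1 := (Submodule.finrank_mono (hle n)).trans (finrank_superJordanSpan_le (d * n))
    have h2 : (d * n + 1) ^ 2 ≤ ((d + 1) * n) ^ 2 := Nat.pow_le_pow_left (by nlinarith) 2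
    have h3 : Module.finrank k ↥(∑ j ∈ Finset.range (n + 1), V ^ j) ≤
        2 * (d + 1) ^ 2 * n ^ 2 := by
      rw [mul_pow] at h2
      linarith
    exact_mod_cast h3
  obtain h0 | h0 := Nat.eq_zero_or_pos (Module.finrank k ↥(∑ j ∈ Finset.range (n + 1), V ^ j))
  · rw [h0, Nat.cast_zero, Real.log_zero]
    refine Real.log_nonneg ?_
    have h4 : 1 ≤ 2 * (d + 1) ^ 2 * n ^ 2 := Nat.one_le_iff_ne_zero.mpr (by positivity)
    exact_mod_cast h4
  · exact Real.log_le_log (by exact_mod_cast h0) hfin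

theorem le_GKdim (h : SuperJordanRel X Y)
    (hli : LinearIndependent k (superJordanMonomial X Y)) : 2 ≤ GKdim k A := by
  have hfd : FiniteDimensional k (Submodule.span k ({1, X, Y} : Set A)) :=
    FiniteDimensional.span_of_finite k (by simp)
  refine le_trans ?_ (le_iSup₂ (Submodule.span k ({1, X, Y} : Set A)) hfd)
  have hC : (0 : ℝ) < 1 / 9 := by norm_num
  rw [← (tendsto_log_mul_sq_div_log hC).limsup_eq]
  refine Filter.limsup_le_limsup ?_
  filter_upwards [Filter.eventually_ge_atTop 1] with n hn
  have hn' : (1 : ℝ) ≤ n := by exact_mod_cast hn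
  refine ENNReal.ofReal_le_ofReal (div_le_div_of_nonneg_right ?_ (Real.log_nonneg hn'))
  refine Real.log_le_log (by positivity) ?_
  rw [h.sum_span_pow]
  have h1 : n ^ 2 ≤ (3 * (n / 3 + 1)) ^ 2 := Nat.pow_le_pow_left (by omega) 2
  have h2 := le_finrank_superJordanSpan hli n
  have h3 : n ^ 2 ≤ 9 * Module.finrank k (superJordanSpan k X Y n) := by
    rw [mul_pow] at h1
    linarith
  have h4 : (n : ℝ) ^ 2 ≤ 9 * Module.finrank k (superJordanSpan k X Y n) := by exact_mod_cast h3
  linarith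

end SuperJordanRel

namespace IsSkewDerivation

variable {k : Type*} [Field k] {D : Fin 2 → (FreeAlgebra k (Fin 2) →ₗ[k] FreeAlgebra k (Fin 2))}

theorem mkAlgHom_eq_zero {x : FreeAlgebra k (Fin 2)} (hx : x ∈ nicholsSet D) :
    RingQuot.mkAlgHom k (nicholsRel D) x = 0 := by
  rw [← map_zero (RingQuot.mkAlgHom k (nicholsRel D))]
  exact RingQuot.mkAlgHom_rel k ⟨hx, rfl⟩

variable [CharZero k]

theorem map_eq_zero_of_mem (hD : IsSkewDerivation D) {A : Type*} [Ring A] [Algebra k A]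
    (f : FreeAlgebra k (Fin 2) →ₐ[k] A)
    (h : SuperJordanRel (f (FreeAlgebra.ι k 0)) (f (FreeAlgebra.ι k 1)))
    (hker : ∀ x, f x = 0 → x ∈ kernelSubmodule D) {x : FreeAlgebra k (Fin 2)}
    (hx : x ∈ kernelSubmodule D) : f x = 0 := by
  have hspan := SuperJordanRel.mem_span_range_monomial f h x
  obtain ⟨c, hc⟩ := Finsupp.mem_span_range_iff_exists_finsupp.mp hspan
  simp_rw [← map_superJordanMonomial, ← map_smul] at hc
  rw [Finsupp.sum, ← map_sum] at hc
  have hsub := hker (∑ p ∈ c.support, c p • (FreeAlgebra.ι k 0 ^ (p.1 : ℕ) * x21 k ^ p.2.1 *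
    FreeAlgebra.ι k 1 ^ p.2.2) - x) (by rw [map_sub, hc, sub_self])
  have hmem := add_mem hsub hx
  rw [sub_add_cancel, ← hD.kernelMk_eq_zero, map_sum] at hmem
  simp_rw [map_smul hD.kernelMk] at hmem
  have hc0 := linearIndependent_iff.mp hD.linearIndependent_kernelMk c hmem
  rw [← hc, hc0]
  simp

theorem span_nicholsSet (hD : IsSkewDerivation D) :
    TwoSidedIdeal.span (nicholsSet D) =
      TwoSidedIdeal.span
        {FreeAlgebra.ι k (0 : Fin 2) * FreeAlgebra.ι k (0 : Fin 2),
         FreeAlgebra.ι k (1 : Fin 2) * x21 k - x21 k * FreeAlgebra.ι k (1 : Fin 2) -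
           FreeAlgebra.ι k (0 : Fin 2) * x21 k} := by
  set R : Set (FreeAlgebra k (Fin 2)) := {FreeAlgebra.ι k (0 : Fin 2) * FreeAlgebra.ι k (0 : Fin 2),
    FreeAlgebra.ι k (1 : Fin 2) * x21 k - x21 k * FreeAlgebra.ι k (1 : Fin 2) -
      FreeAlgebra.ι k (0 : Fin 2) * x21 k} with hR
  have hRsub : R ⊆ nicholsSet D := by
    rintro _ (rfl | rfl)
    · exact hD.sq_mem_nicholsSet
    · exact hD.comm_rel_mem_nicholsSet
  refine le_antisymm (TwoSidedIdeal.span_le.mpr fun x hx => ?_) (TwoSidedIdeal.span_mono hRsub)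
  let f := Ideal.Quotient.mkₐ k (TwoSidedIdeal.span R).asIdeal
  have hf (y : FreeAlgebra k (Fin 2)) : f y = 0 ↔ y ∈ TwoSidedIdeal.span R :=
    Ideal.Quotient.eq_zero_iff_mem
  have hrel : SuperJordanRel (f (FreeAlgebra.ι k 0)) (f (FreeAlgebra.ι k 1)) := by
    constructor
    · rw [← map_mul, hf]
      exact TwoSidedIdeal.subset_span (by simp [hR])
    · have : f (FreeAlgebra.ι k 1 * x21 k - x21 k * FreeAlgebra.ι k 1 -
          FreeAlgebra.ι k 0 * x21 k) = 0 := (hf _).mpr (TwoSidedIdeal.subset_span (by simp [hR]))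
      simpa [x21] using this
  have hle : TwoSidedIdeal.span R ≤ hD.kernel.toTwoSided :=
    TwoSidedIdeal.span_le.mpr fun y hy =>
      Ideal.mem_toTwoSided.mpr (hD.nicholsSet_subset (hRsub hy))
  exact (hf x).mp (hD.map_eq_zero_of_mem f hrel
    (fun y hy => Ideal.mem_toTwoSided.mp (hle ((hf y).mp hy))) (hD.nicholsSet_subset hx))

theorem linearIndependent_mkAlgHom (hD : IsSkewDerivation D) :
    LinearIndependent k
      (fun p : Fin 2 × ℕ × ℕ => RingQuot.mkAlgHom k (nicholsRel D)
        (FreeAlgebra.ι k (0 : Fin 2) ^ (p.1 : ℕ) * x21 k ^ p.2.1 *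
          FreeAlgebra.ι k (1 : Fin 2) ^ p.2.2)) := by
  let g : RingQuot (nicholsRel D) →ₐ[k] FreeAlgebra k (Fin 2) ⧸ hD.kernel :=
    RingQuot.liftAlgHom k ⟨hD.kernelMk, by
      rintro x _ ⟨hx, rfl⟩
      rw [map_zero]
      exact hD.kernelMk_eq_zero.mpr (hD.nicholsSet_subset hx)⟩
  refine LinearIndependent.of_comp g.toLinearMap ?_
  have hg : (g.toLinearMap ∘ fun p : Fin 2 × ℕ × ℕ => RingQuot.mkAlgHom k (nicholsRel D)
      (FreeAlgebra.ι k (0 : Fin 2) ^ (p.1 : ℕ) * x21 k ^ p.2.1 *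
        FreeAlgebra.ι k (1 : Fin 2) ^ p.2.2)) = fun p => hD.kernelMk
      (FreeAlgebra.ι k (0 : Fin 2) ^ (p.1 : ℕ) * x21 k ^ p.2.1 *
        FreeAlgebra.ι k (1 : Fin 2) ^ p.2.2) :=
    funext fun p => RingQuot.liftAlgHom_mkAlgHom_apply k _ _ _
  rw [hg]
  exact hD.linearIndependent_kernelMk

end IsSkewDerivation

/-- the super Jordan plane.  `J(V(-1,2))` is generated as a two-sided ideal by
`x₁²` and `x₂x₂₁ - x₂₁x₂ - x₁x₂₁`; the monomials `x₁^a x₂₁^b x₂^c` (`a ∈ {0,1}`, `b,c ∈ ℕ`)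
form a basis of `B(V(-1,2))`; and `GKdim B(V(-1,2)) = 2`. -/
theorem statement3 (k : Type*) [Field k] [IsAlgClosed k] [CharZero k]
    (D : Fin 2 → (FreeAlgebra k (Fin 2) →ₗ[k] FreeAlgebra k (Fin 2)))
    (hD1 : ∀ i, D i (1 : FreeAlgebra k (Fin 2)) = 0)
    (hDx : ∀ i j, D i (FreeAlgebra.ι k j) = if i = j then 1 else 0)
    (hDmul : ∀ i (u v : FreeAlgebra k (Fin 2)),
      D i (u * v) = D i u * superJordanAut k v + u * D i v) :
    TwoSidedIdeal.span (nicholsSet D) =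
      TwoSidedIdeal.span
        {FreeAlgebra.ι k (0 : Fin 2) * FreeAlgebra.ι k (0 : Fin 2),
         FreeAlgebra.ι k (1 : Fin 2) * x21 k - x21 k * FreeAlgebra.ι k (1 : Fin 2) -
           FreeAlgebra.ι k (0 : Fin 2) * x21 k} ∧
    (LinearIndependent k
        (fun p : Fin 2 × ℕ × ℕ => RingQuot.mkAlgHom k (nicholsRel D)
          (FreeAlgebra.ι k (0 : Fin 2) ^ (p.1 : ℕ) * x21 k ^ p.2.1 *
            FreeAlgebra.ι k (1 : Fin 2) ^ p.2.2)) ∧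
      Submodule.span k
        (Set.range (fun p : Fin 2 × ℕ × ℕ => RingQuot.mkAlgHom k (nicholsRel D)
          (FreeAlgebra.ι k (0 : Fin 2) ^ (p.1 : ℕ) * x21 k ^ p.2.1 *
            FreeAlgebra.ι k (1 : Fin 2) ^ p.2.2))) = ⊤) ∧
    GKdim k (RingQuot (nicholsRel D)) = 2 := by
  have hD : IsSkewDerivation D := ⟨hD1, hDx, hDmul⟩
  have hrel := hD.superJordanRel_of_map (RingQuot.mkAlgHom k (nicholsRel D))
    fun _ hx => IsSkewDerivation.mkAlgHom_eq_zero hx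
  have hli := hD.linearIndependent_mkAlgHom
  refine ⟨hD.span_nicholsSet, ⟨hli, ?_⟩, ?_⟩
  · refine eq_top_iff.mpr fun x _ => ?_
    obtain ⟨y, rfl⟩ := RingQuot.mkAlgHom_surjective k (nicholsRel D) x
    simp_rw [map_superJordanMonomial]
    exact SuperJordanRel.mem_span_range_monomial _ hrel y
  · simp_rw [map_superJordanMonomial] at hli
    refine le_antisymm (hrel.GKdim_le fun x => ?_) (hrel.le_GKdim hli)
    obtain ⟨y, rfl⟩ := RingQuot.mkAlgHom_surjective k (nicholsRel D) x
    exact SuperJordanRel.exists_mem_superJordanSpan _ hrel y
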